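/- arXiv:1903.02713 — 2 statements merged into one kernel-verified Lean document; each statement's English description precedes it below -/
import Mathlib

section
/- Let (A, c) be convenient and non-degenerate data and F : ℂ^n → ℂ the associated exponential sum. Then for every ε > 0 and every integer k ≥ 2, the function t ↦ ε ‖∇F(t)‖^k − ‖D^k F(t)‖ tends to +∞ as ‖Re t‖ → +∞ (i.e., for every R > 0 there exists K > 0 such that ‖(Re t_1, …, Re t_n)‖ ≥ K implies ε ‖∇F(t)‖^k − ‖D^k F(t)‖ ≥ R). This expresses, in logarithmic coordinates, that a convenient non-degenerate Laurent polynomial on (ℂ^*)^n with its standard complete flat metric is strongly elliptic. -/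
open scoped BigOperators

/-- The exponential sum `F(t) = Σ_{α ∈ A} c(α) exp(⟨α, t⟩)`, i.e. the Laurent
polynomial `Σ c(α) z^α` on `(ℂ^*)^n` in logarithmic coordinates `z_j = e^{t_j}`. -/
noncomputable def expSum (n : ℕ) (A : Finset (Fin n → ℤ)) (c : (Fin n → ℤ) → ℂ)
    (t : EuclideanSpace ℂ (Fin n)) : ℂ :=
  ∑ α ∈ A, c α * Complex.exp (∑ j : Fin n, (α j : ℂ) * t j)

/-- Convenient: `0` lies in the interior of the convex hull of `A` in `ℝ^n`. -/
def Convenient (n : ℕ) (A : Finset (Fin n → ℤ)) : Prop :=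
  (0 : Fin n → ℝ) ∈ interior (convexHull ℝ
    ((fun α : Fin n → ℤ => fun j => (α j : ℝ)) '' (A : Set (Fin n → ℤ))))

open Classical in
/-- The subset `A_u ⊆ A` of exponents lying on the face of the Newton polytope
supported by `u`. -/
noncomputable def faceSet (n : ℕ) (A : Finset (Fin n → ℤ)) (hA : A.Nonempty)
    (u : Fin n → ℝ) : Finset (Fin n → ℤ) :=
  A.filter (fun α => ∑ j : Fin n, (α j : ℝ) * u j
    = A.sup' hA (fun β => ∑ j : Fin n, (β j : ℝ) * u j))

/-- Non-degenerate: for every `u`, the face polynomial and its logarithmic derivatives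
have no common zero on `(ℂ∖{0})^n`. -/
def NonDegenerate (n : ℕ) (A : Finset (Fin n → ℤ)) (hA : A.Nonempty)
    (c : (Fin n → ℤ) → ℂ) : Prop :=
  ∀ u : Fin n → ℝ, ¬ ∃ z : Fin n → ℂ, (∀ j, z j ≠ 0) ∧
    (∑ α ∈ faceSet n A hA u, c α * ∏ j : Fin n, z j ^ (α j)) = 0 ∧
    ∀ i : Fin n, (∑ α ∈ faceSet n A hA u, c α * (α i : ℂ) * ∏ j : Fin n, z j ^ (α j)) = 0

/-- The norm of the gradient `(Σ_i |∂F/∂t_i(t)|²)^{1/2}`. -/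
noncomputable def gradNorm (n : ℕ) (F : EuclideanSpace ℂ (Fin n) → ℂ)
    (t : EuclideanSpace ℂ (Fin n)) : ℝ :=
  Real.sqrt (∑ i : Fin n, ‖fderiv ℂ F t (EuclideanSpace.single i 1)‖ ^ 2)

/-- The Euclidean norm of the real part `Re t = (Re t_1, …, Re t_n)`. -/
noncomputable def reNorm (n : ℕ) (t : EuclideanSpace ℂ (Fin n)) : ℝ :=
  Real.sqrt (∑ i : Fin n, (t i).re ^ 2)

open Filter Topology

/-- The support function `x ↦ max_{α ∈ A} ⟨α, x⟩` of the Newton polytope. -/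
noncomputable def supportFn {n : ℕ} (A : Finset (Fin n → ℤ)) (hA : A.Nonempty)
    (x : Fin n → ℝ) : ℝ :=
  A.sup' hA (fun β => ∑ j : Fin n, (β j : ℝ) * x j)

lemma le_supportFn {n : ℕ} {A : Finset (Fin n → ℤ)} (hA : A.Nonempty)
    {α : Fin n → ℤ} (hα : α ∈ A) (x : Fin n → ℝ) :
    ∑ j, (α j : ℝ) * x j ≤ supportFn A hA x :=
  Finset.le_sup' (fun β : Fin n → ℤ => ∑ j : Fin n, (β j : ℝ) * x j) hα

lemma exists_eq_supportFn {n : ℕ} {A : Finset (Fin n → ℤ)} (hA : A.Nonempty)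
    (x : Fin n → ℝ) : ∃ α ∈ A, ∑ j, (α j : ℝ) * x j = supportFn A hA x := by
  obtain ⟨α, hα, h⟩ := Finset.exists_mem_eq_sup' hA
    (fun β : Fin n → ℤ => ∑ j : Fin n, (β j : ℝ) * x j)
  exact ⟨α, hα, h.symm⟩

lemma mem_faceSet {n : ℕ} {A : Finset (Fin n → ℤ)} {hA : A.Nonempty}
    {u : Fin n → ℝ} {α : Fin n → ℤ} :
    α ∈ faceSet n A hA u ↔ α ∈ A ∧ ∑ j, (α j : ℝ) * u j = supportFn A hA u := by
  simp [faceSet, supportFn]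

/-- For convenient data the support function grows at least linearly. -/
lemma Convenient.exists_mul_norm_le {n : ℕ} {A : Finset (Fin n → ℤ)} (hA : A.Nonempty)
    (h : Convenient n A) :
    ∃ δ > (0 : ℝ), ∀ x : Fin n → ℝ, δ * Real.sqrt (∑ j, x j ^ 2) ≤ supportFn A hA x := by
  obtain ⟨r, hr, hball⟩ := Metric.isOpen_iff.1 isOpen_interior _ h
  refine ⟨r / 2, by positivity, fun x => ?_⟩
  set N := Real.sqrt (∑ j, x j ^ 2) with hN
  have hN0 : 0 ≤ N := Real.sqrt_nonneg _
  have hsq : N ^ 2 = ∑ j, x j ^ 2 := Real.sq_sqrt (Finset.sum_nonneg fun j _ => sq_nonneg _)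
  have hle : ∀ j, |x j| ≤ N := fun j => Real.abs_le_sqrt
    (Finset.single_le_sum (f := fun j => x j ^ 2) (fun j _ => sq_nonneg _) (Finset.mem_univ j))
  have hull : ∀ p ∈ convexHull ℝ
      ((fun α : Fin n → ℤ => fun j => (α j : ℝ)) '' (A : Set (Fin n → ℤ))),
      ∑ j, p j * x j ≤ supportFn A hA x := by
    have hconv : Convex ℝ {p : Fin n → ℝ | ∑ j, p j * x j ≤ supportFn A hA x} := by
      refine convex_halfSpace_le ⟨fun p q => ?_, fun a p => ?_⟩ _
      · simp [add_mul, Finset.sum_add_distrib]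
      · simp [Finset.mul_sum, mul_assoc]
    have hsub := convexHull_min (s := (fun α : Fin n → ℤ => fun j => (α j : ℝ)) ''
      (A : Set (Fin n → ℤ))) (by
        rintro _ ⟨α, hα, rfl⟩
        exact le_supportFn hA hα x) hconv
    exact fun p hp => hsub hp
  have hmem : (fun j => r / 2 / N * x j) ∈ Metric.ball (0 : Fin n → ℝ) r := by
    rw [mem_ball_zero_iff]
    refine lt_of_le_of_lt ((pi_norm_le_iff_of_nonneg (by positivity : 0 ≤ r / 2)).2
      fun j => ?_) (half_lt_self hr)
    rw [Real.norm_eq_abs, abs_mul, abs_of_nonneg (by positivity), div_mul_eq_mul_div]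
    exact div_le_of_le_mul₀ hN0 (by positivity)
      (mul_le_mul_of_nonneg_left (hle j) (by positivity))
  have key := hull _ (interior_subset (hball hmem))
  have heq : ∑ j, r / 2 / N * x j * x j = r / 2 * N := by
    simp_rw [mul_assoc, ← Finset.mul_sum, ← sq, ← hsq]
    rcases eq_or_ne N 0 with h0 | h0
    · simp [h0]
    · field_simp
  linarith [heq ▸ key]

/-- Every linear map between finite-dimensional real spaces of functions has a continuous
generalized inverse. -/
lemma exists_generalizedInverse {ι κ : Type*} [Fintype ι] [Fintype κ]
    (T : (ι → ℝ) →ₗ[ℝ] (κ → ℝ)) :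
    ∃ g : (κ → ℝ) →L[ℝ] (ι → ℝ), ∀ x, T (g (T x)) = T x := by
  obtain ⟨g, hg⟩ := T.rangeRestrict.exists_rightInverse_of_surjective T.range_rangeRestrict
  obtain ⟨G, hG⟩ := g.exists_extend
  refine ⟨LinearMap.toContinuousLinearMap G, fun x => ?_⟩
  have h1 : G (T x) = g (T.rangeRestrict x) := LinearMap.congr_fun hG (T.rangeRestrict x)
  have h2 := congrArg Subtype.val (LinearMap.congr_fun hg (T.rangeRestrict x))
  simpa [h1] using h2

/-- Along an ultrafilter on which the support function tends to infinity, the normalized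
monomials `exp (⟨α, x⟩ - max_β ⟨β, x⟩)` converge to a multiple of a point evaluation on a
proper face, and to zero off that face. -/
lemma exists_face_tendsto {n : ℕ} {A : Finset (Fin n → ℤ)} (hA : A.Nonempty) {ι : Type*}
    (f : Ultrafilter ι) (x : ι → Fin n → ℝ)
    (hx : Tendsto (fun m => supportFn A hA (x m)) f atTop) :
    ∃ u v : Fin n → ℝ, ∃ ρ > (0 : ℝ), 0 < supportFn A hA u ∧
      (∀ α ∈ faceSet n A hA u,
        Tendsto (fun m => Real.exp (∑ j, (α j : ℝ) * x m j - supportFn A hA (x m))) f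
          (𝓝 (ρ * Real.exp (∑ j, (α j : ℝ) * v j)))) ∧
      ∀ α ∈ A, α ∉ faceSet n A hA u →
        Tendsto (fun m => Real.exp (∑ j, (α j : ℝ) * x m j - supportFn A hA (x m))) f (𝓝 0) := by
  classical
  have hlim : ∀ α ∈ A, ∃ r : ℝ,
      Tendsto (fun m => Real.exp (∑ j, (α j : ℝ) * x m j - supportFn A hA (x m))) f (𝓝 r) := by
    intro α hα
    obtain ⟨r, -, hr⟩ := (isCompact_Icc (a := (0 : ℝ)) (b := 1)).ultrafilter_le_nhds
      (f.map fun m => Real.exp (∑ j, (α j : ℝ) * x m j - supportFn A hA (x m)))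
      (by
        simp only [le_principal_iff, Ultrafilter.mem_coe, Ultrafilter.mem_map]
        refine Filter.univ_mem' fun m => ⟨(Real.exp_pos _).le, ?_⟩
        exact Real.exp_le_one_iff.2 (sub_nonpos.2 (le_supportFn hA hα _)))
    exact ⟨r, hr⟩
  choose! r hr using hlim
  obtain ⟨α₀, hα₀, hmax⟩ : ∃ α ∈ A,
      ∀ᶠ m in f, ∑ j, (α j : ℝ) * x m j = supportFn A hA (x m) := by
    have := (Ultrafilter.finite_biUnion_mem_iff (f := f) A.finite_toSet
      (s := fun α => {m | ∑ j, (α j : ℝ) * x m j = supportFn A hA (x m)})).1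
      (Filter.univ_mem' fun m => by simpa using exists_eq_supportFn hA (x m))
    obtain ⟨α, hα, h⟩ := this
    exact ⟨α, hα, h⟩
  set S : Finset (Fin n → ℤ) := A.filter fun α => r α ≠ 0
  have hdiff : ∀ α ∈ A,
      Tendsto (fun m => Real.exp (∑ j, ((α j : ℝ) - α₀ j) * x m j)) f (𝓝 (r α)) := by
    intro α hα
    refine (hr α hα).congr' ?_
    filter_upwards [hmax] with m hm
    simp [← hm, sub_mul]
  let T : (Fin n → ℝ) →ₗ[ℝ] (S → ℝ) :=
    { toFun := fun y α => ∑ j, ((α.1 j : ℝ) - α₀ j) * y j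
      map_add' := fun y z => by ext; simp [mul_add, Finset.sum_add_distrib]
      map_smul' := fun a y => by
        ext; simp only [Pi.smul_apply, smul_eq_mul, RingHom.id_apply, Finset.mul_sum]
        exact Finset.sum_congr rfl fun j _ => by ring }
  obtain ⟨g, hg⟩ := exists_generalizedInverse T
  have hTlim : Tendsto (fun m => T (x m)) f (𝓝 fun α : S => Real.log (r α.1)) := by
    refine tendsto_pi_nhds.2 fun α => ?_
    obtain ⟨hα, hα0⟩ := Finset.mem_filter.1 α.2
    refine ((hdiff α.1 hα).log hα0).congr fun m => ?_
    rw [Real.log_exp]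
    rfl
  set v := g fun α : S => Real.log (r α.1)
  have hv : Tendsto (fun m => g (T (x m))) f (𝓝 v) := (g.continuous.tendsto _).comp hTlim
  have hvlin : ∀ a : Fin n → ℝ,
      Tendsto (fun m => ∑ j, a j * g (T (x m)) j) f (𝓝 (∑ j, a j * v j)) := fun a =>
    tendsto_finsetSum _ fun j _ => (tendsto_pi_nhds.1 hv j).const_mul _
  have hy : ∀ m, ∀ α ∈ S, ∑ j, ((α j : ℝ) - α₀ j) * g (T (x m)) j
      = ∑ j, ((α j : ℝ) - α₀ j) * x m j := fun m α hα => congrFun (hg (x m)) ⟨α, hα⟩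
  have hpos : ∀ᶠ m in f, 0 < ∑ j, (α₀ j : ℝ) * (x m - g (T (x m))) j := by
    have : Tendsto (fun m => ∑ j, (α₀ j : ℝ) * (x m - g (T (x m))) j) f atTop := by
      refine (hx.atTop_add (hvlin fun j => (α₀ j : ℝ)).neg).congr' ?_
      filter_upwards [hmax] with m hm
      simp [← hm, mul_sub, ← sub_eq_add_neg]
    exact this.eventually_gt_atTop 0
  have hoff : ∀ᶠ m in f, ∀ α ∈ A, r α = 0 →
      ∑ j, ((α j : ℝ) - α₀ j) * (x m - g (T (x m))) j < 0 := by
    refine (Filter.eventually_all_finset A).2 fun α hα => ?_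
    by_cases h0 : r α = 0
    · have h1 := (hdiff α hα).mul (hvlin fun j => ((α j : ℝ) - α₀ j)).neg.rexp
      rw [h0, zero_mul] at h1
      filter_upwards [h1.eventually_lt_const one_pos] with m hm _
      rw [← Real.exp_add, Real.exp_lt_one_iff] at hm
      simpa only [Pi.sub_apply, mul_sub, Finset.sum_sub_distrib, ← sub_eq_add_neg] using hm
    · exact Eventually.of_forall fun m h => absurd h h0
  obtain ⟨m, hm_pos, hm_off⟩ := (hpos.and hoff).exists
  set u := x m - g (T (x m)) with hu
  have hon : ∀ α ∈ S, ∑ j, (α j : ℝ) * u j = ∑ j, (α₀ j : ℝ) * u j := by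
    intro α hα
    have h := hy m α hα
    rw [← sub_eq_zero, ← Finset.sum_sub_distrib] at h ⊢
    rw [← neg_eq_zero, ← Finset.sum_neg_distrib, ← h]
    exact Finset.sum_congr rfl fun j _ => by simp only [hu, Pi.sub_apply]; ring
  have hlt : ∀ α ∈ A, r α = 0 → ∑ j, (α j : ℝ) * u j < ∑ j, (α₀ j : ℝ) * u j := by
    intro α hα h0
    have h := hm_off α hα h0
    simpa [sub_mul] using h
  have hMu : supportFn A hA u = ∑ j, (α₀ j : ℝ) * u j := by
    refine le_antisymm (Finset.sup'_le hA _ fun α hα => ?_) (le_supportFn hA hα₀ u)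
    by_cases h0 : r α = 0
    · exact (hlt α hα h0).le
    · exact (hon α (Finset.mem_filter.2 ⟨hα, h0⟩)).le
  have hface : ∀ α ∈ A, (α ∈ faceSet n A hA u ↔ r α ≠ 0) := by
    intro α hα
    rw [mem_faceSet, hMu]
    exact ⟨fun h h0 => (hlt α hα h0).ne h.2,
      fun h0 => ⟨hα, hon α (Finset.mem_filter.2 ⟨hα, h0⟩)⟩⟩
  refine ⟨u, v, Real.exp (-∑ j, (α₀ j : ℝ) * v j), Real.exp_pos _, hMu ▸ hm_pos, ?_, ?_⟩
  · intro α hα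
    have hαA := (mem_faceSet.1 hα).1
    have h0 := (hface α hαA).1 hα
    have hrα : r α = Real.exp (∑ j, ((α j : ℝ) - α₀ j) * v j) := by
      refine tendsto_nhds_unique (hdiff α hαA)
        ((hvlin fun j => ((α j : ℝ) - α₀ j)).rexp.congr fun m => ?_)
      rw [hy m α (Finset.mem_filter.2 ⟨hαA, h0⟩)]
    convert hr α hαA using 2
    rw [hrα, ← Real.exp_add]
    congr 1
    simp only [sub_mul, Finset.sum_sub_distrib]
    ring
  · intro α hα hnot
    have h0 : r α = 0 := by
      by_contra h
      exact hnot ((hface α hα).2 h)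
    exact h0 ▸ hr α hα

/-- The complex linear form `t ↦ ⟨α, t⟩`. -/
noncomputable def exponentForm {n : ℕ} (α : Fin n → ℤ) : EuclideanSpace ℂ (Fin n) →L[ℂ] ℂ :=
  ∑ j, (α j : ℂ) • EuclideanSpace.proj j

lemma exponentForm_apply {n : ℕ} (α : Fin n → ℤ) (t : EuclideanSpace ℂ (Fin n)) :
    exponentForm α t = ∑ j, (α j : ℂ) * t j := by
  simp [exponentForm]

lemma exponentForm_re {n : ℕ} (α : Fin n → ℤ) (t : EuclideanSpace ℂ (Fin n)) :
    (exponentForm α t).re = ∑ j, (α j : ℝ) * (t j).re := by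
  simp [exponentForm_apply]

lemma expSum_eq {n : ℕ} (A : Finset (Fin n → ℤ)) (c : (Fin n → ℤ) → ℂ) :
    expSum n A c = fun t => ∑ α ∈ A, c α • Complex.exp (exponentForm α t) := by
  funext t
  simp [expSum, exponentForm_apply]

lemma fderiv_expSum_single {n : ℕ} (A : Finset (Fin n → ℤ)) (c : (Fin n → ℤ) → ℂ)
    (t : EuclideanSpace ℂ (Fin n)) (i : Fin n) :
    fderiv ℂ (expSum n A c) t (EuclideanSpace.single i 1)
      = ∑ α ∈ A, c α * (α i : ℂ) * Complex.exp (exponentForm α t) := by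
  have h : HasFDerivAt (expSum n A c)
      (∑ α ∈ A, c α • (Complex.exp (exponentForm α t) • exponentForm α)) t := by
    rw [expSum_eq]
    exact HasFDerivAt.fun_sum fun α _ =>
      ((exponentForm α).hasFDerivAt.cexp).const_smul (c α)
  rw [h.fderiv, _root_.sum_apply]
  refine Finset.sum_congr rfl fun α _ => ?_
  have : exponentForm α (EuclideanSpace.single i 1) = α i := by
    simp [exponentForm_apply]
  simp only [_root_.smul_apply, this, smul_eq_mul]
  ring

/-- Each derivative of an exponential sum is bounded by the exponential of the support
function. -/
lemma exists_norm_iteratedFDeriv_expSum_le {n : ℕ} (A : Finset (Fin n → ℤ)) (hA : A.Nonempty)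
    (c : (Fin n → ℤ) → ℂ) (k : ℕ) :
    ∃ B : ℝ, 0 ≤ B ∧ ∀ t : EuclideanSpace ℂ (Fin n), ‖iteratedFDeriv ℂ k (expSum n A c) t‖
      ≤ B * Real.exp (supportFn A hA fun j => (t j).re) := by
  refine ⟨∑ α ∈ A, ‖c α‖ * ‖exponentForm α‖ ^ k,
    Finset.sum_nonneg fun α _ => by positivity, fun t => ?_⟩
  have hsmooth : ∀ α : Fin n → ℤ,
      ContDiff ℂ k fun t : EuclideanSpace ℂ (Fin n) => Complex.exp (exponentForm α t) :=
    fun α => (exponentForm α).contDiff.cexp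
  rw [expSum_eq, iteratedFDeriv_fun_sum_apply
    fun α _ => ((hsmooth α).const_smul (c α)).contDiffAt, Finset.sum_mul]
  refine (norm_sum_le _ _).trans (Finset.sum_le_sum fun α hα => ?_)
  rw [iteratedFDeriv_const_smul_apply' (hsmooth α).contDiffAt, norm_smul, mul_assoc]
  refine mul_le_mul_of_nonneg_left ?_ (norm_nonneg _)
  have hcomp := (exponentForm α).iteratedFDeriv_comp_right (Complex.contDiff_exp (n := k)) t
    (le_refl (k : WithTop ℕ∞))
  change ‖iteratedFDeriv ℂ k (Complex.exp ∘ exponentForm α) t‖ ≤ _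
  rw [hcomp]
  refine (ContinuousMultilinearMap.norm_compContinuousLinearMap_le _ _).trans ?_
  rw [norm_iteratedFDeriv_eq_norm_iteratedDeriv, iteratedDeriv_eq_iterate,
    Complex.iter_deriv_exp, Complex.norm_exp,
    Finset.prod_const, Finset.card_univ, Fintype.card_fin, mul_comm, exponentForm_re]
  exact mul_le_mul_of_nonneg_left (Real.exp_le_exp.2 (le_supportFn hA hα _)) (by positivity)

lemma exp_exponentForm_eq {n : ℕ} (α : Fin n → ℤ) (t : EuclideanSpace ℂ (Fin n)) :
    Complex.exp (exponentForm α t) = Real.exp (∑ j, (α j : ℝ) * (t j).re)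
      * ∏ j, (Circle.exp (t j).im : ℂ) ^ α j := by
  simp_rw [exponentForm_apply, Circle.coe_exp, ← Complex.exp_int_mul, ← Complex.exp_sum]
  push_cast
  rw [← Complex.exp_add, ← Finset.sum_add_distrib]
  congr 1
  refine Finset.sum_congr rfl fun j _ => ?_
  conv_lhs => rw [← Complex.re_add_im (t j)]
  ring

/-- For convenient non-degenerate data the gradient is bounded below by the exponential of the
support function as soon as `‖Re t‖` is large. -/
lemma NonDegenerate.exists_mul_exp_le_gradNorm {n : ℕ} {A : Finset (Fin n → ℤ)}
    {hA : A.Nonempty} {c : (Fin n → ℤ) → ℂ} (hconv : Convenient n A)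
    (hnd : NonDegenerate n A hA c) :
    ∃ C > (0 : ℝ), ∃ K : ℝ, ∀ t : EuclideanSpace ℂ (Fin n), K ≤ reNorm n t →
      C * Real.exp (supportFn A hA fun j => (t j).re) ≤ gradNorm n (expSum n A c) t := by
  by_contra! hcon
  obtain ⟨δ, hδ, hgrow⟩ := hconv.exists_mul_norm_le hA
  choose t ht_re ht_grad using fun m : ℕ =>
    hcon (1 / ((m : ℝ) + 1)) (by positivity) m
  let f : Ultrafilter ℕ := hyperfilter ℕ
  have hf : (f : Filter ℕ) ≤ atTop := Nat.hyperfilter_le_atTop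
  set x : ℕ → Fin n → ℝ := fun m j => (t m j).re
  have hx : Tendsto (fun m => supportFn A hA (x m)) f atTop := by
    refine tendsto_atTop_mono (fun m => ?_)
      ((tendsto_natCast_atTop_atTop.mono_left hf).const_mul_atTop hδ)
    exact (mul_le_mul_of_nonneg_left (ht_re m) hδ.le).trans (hgrow (x m))
  obtain ⟨u, v, ρ, hρ, hu, hface, hoff⟩ := exists_face_tendsto hA f x hx
  obtain ⟨ζ, -, hζ⟩ := (isCompact_univ (X := Fin n → Circle)).ultrafilter_le_nhds
    (f.map fun m j => Circle.exp (t m j).im) (by simp)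
  replace hζ : Tendsto (fun m j => Circle.exp (t m j).im) f (𝓝 ζ) := hζ
  have hphase : ∀ α : Fin n → ℤ, Tendsto (fun m => ∏ j, (Circle.exp (t m j).im : ℂ) ^ α j) f
      (𝓝 (∏ j, (ζ j : ℂ) ^ α j)) := fun α =>
    tendsto_finsetProd _ fun j _ =>
      ((continuous_subtype_val.tendsto _).comp (tendsto_pi_nhds.1 hζ j)).zpow₀ _
        (Or.inl (Circle.coe_ne_zero _))
  set z : Fin n → ℂ := fun j => Real.exp (v j) * ζ j
  have hz : ∀ α : Fin n → ℤ, ∏ j, z j ^ α j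
      = Real.exp (∑ j, (α j : ℝ) * v j) * ∏ j, (ζ j : ℂ) ^ α j := by
    intro α
    simp only [z, mul_zpow, Finset.prod_mul_distrib]
    congr 1
    push_cast
    simp_rw [← Complex.exp_int_mul, ← Complex.exp_sum]
  have hsub : faceSet n A hA u ⊆ A := fun α hα => (mem_faceSet.1 hα).1
  have hgrad : ∀ i, ∑ α ∈ faceSet n A hA u, c α * (α i : ℂ) * ∏ j, z j ^ α j = 0 := by
    intro i
    have hlim : Tendsto (fun m => ∑ α ∈ A, c α * (α i : ℂ) *
        ((Real.exp (∑ j, (α j : ℝ) * x m j - supportFn A hA (x m)) : ℂ)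
          * ∏ j, (Circle.exp (t m j).im : ℂ) ^ α j)) f
        (𝓝 (∑ α ∈ faceSet n A hA u, c α * (α i : ℂ) * (ρ * ∏ j, z j ^ α j))) := by
      rw [Finset.sum_subset_zero_on_sdiff (g := fun α => if α ∈ faceSet n A hA u then
        c α * (α i : ℂ) * (ρ * ∏ j, z j ^ α j) else 0) hsub
        (fun α hα => if_neg (Finset.mem_sdiff.1 hα).2) (fun α hα => (if_pos hα).symm)]
      refine tendsto_finsetSum _ fun α hα => ?_
      split_ifs with h
      · refine Tendsto.const_mul _ ?_
        rw [hz, ← mul_assoc, ← Complex.ofReal_mul]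
        exact ((Complex.continuous_ofReal.tendsto _).comp (hface α h)).mul (hphase α)
      · have := ((Complex.continuous_ofReal.tendsto _).comp (hoff α hα h)).mul (hphase α)
        simpa using this.const_mul (c α * (α i : ℂ))
    have hzero : Tendsto (fun m => ∑ α ∈ A, c α * (α i : ℂ) *
        ((Real.exp (∑ j, (α j : ℝ) * x m j - supportFn A hA (x m)) : ℂ)
          * ∏ j, (Circle.exp (t m j).im : ℂ) ^ α j)) f (𝓝 0) := by
      refine squeeze_zero_norm (fun m => ?_)
        ((tendsto_one_div_add_atTop_nhds_zero_nat (𝕜 := ℝ)).mono_left hf)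
      have heq : ∑ α ∈ A, c α * (α i : ℂ) *
          ((Real.exp (∑ j, (α j : ℝ) * x m j - supportFn A hA (x m)) : ℂ)
            * ∏ j, (Circle.exp (t m j).im : ℂ) ^ α j)
          = fderiv ℂ (expSum n A c) (t m) (EuclideanSpace.single i 1)
            * (Real.exp (-supportFn A hA (x m)) : ℂ) := by
        rw [fderiv_expSum_single, Finset.sum_mul]
        refine Finset.sum_congr rfl fun α _ => ?_
        rw [exp_exponentForm_eq, sub_eq_add_neg, Real.exp_add, Complex.ofReal_mul]
        ring
      have hle : ‖fderiv ℂ (expSum n A c) (t m) (EuclideanSpace.single i 1)‖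
          ≤ gradNorm n (expSum n A c) (t m) :=
        Real.le_sqrt_of_sq_le (Finset.single_le_sum
          (f := fun i => ‖fderiv ℂ (expSum n A c) (t m) (EuclideanSpace.single i 1)‖ ^ 2)
          (fun _ _ => sq_nonneg _) (Finset.mem_univ i))
      rw [heq, norm_mul, Complex.norm_real, Real.norm_of_nonneg (Real.exp_pos _).le,
        Real.exp_neg, ← div_eq_mul_inv, div_le_iff₀ (Real.exp_pos _)]
      exact hle.trans (ht_grad m).le
    have h0 := tendsto_nhds_unique hlim hzero
    have hρ' : (ρ : ℂ) ≠ 0 := Complex.ofReal_ne_zero.2 hρ.ne'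
    refine (mul_eq_zero.1 (?_ : (ρ : ℂ) * _ = 0)).resolve_left hρ'
    rw [← h0, Finset.mul_sum]
    exact Finset.sum_congr rfl fun α _ => by ring
  refine hnd u ⟨z, fun j => mul_ne_zero (Complex.ofReal_ne_zero.2 (Real.exp_pos _).ne')
    (Circle.coe_ne_zero _), ?_, hgrad⟩
  -- Euler relation on the face
  have hu' : (supportFn A hA u : ℂ) ≠ 0 := Complex.ofReal_ne_zero.2 hu.ne'
  refine (mul_eq_zero.1 (?_ : (supportFn A hA u : ℂ) * _ = 0)).resolve_left hu'
  calc (supportFn A hA u : ℂ) * ∑ α ∈ faceSet n A hA u, c α * ∏ j, z j ^ α j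
      = ∑ α ∈ faceSet n A hA u, ∑ i, (u i : ℂ) * (c α * (α i : ℂ) * ∏ j, z j ^ α j) := by
        rw [Finset.mul_sum]
        refine Finset.sum_congr rfl fun α hα => ?_
        rw [← (mem_faceSet.1 hα).2]
        push_cast
        rw [Finset.sum_mul]
        exact Finset.sum_congr rfl fun i _ => by ring
    _ = 0 := by
        rw [Finset.sum_comm]
        refine Finset.sum_eq_zero fun i _ => ?_
        rw [← Finset.mul_sum, hgrad i, mul_zero]

/-- a convenient non-degenerate Laurent polynomial is strongly elliptic
in logarithmic coordinates: for every `ε > 0` and integer `k ≥ 2`,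
`ε ‖∇F(t)‖^k − ‖D^k F(t)‖ → +∞` as `‖Re t‖ → +∞`. -/
theorem stmt5 (n : ℕ) (hn : 0 < n) (A : Finset (Fin n → ℤ)) (hA : A.Nonempty)
    (c : (Fin n → ℤ) → ℂ) (hc : ∀ α ∈ A, c α ≠ 0)
    (hconv : Convenient n A) (hnd : NonDegenerate n A hA c) :
    ∀ ε > (0 : ℝ), ∀ k : ℕ, 2 ≤ k →
      ∀ R > (0 : ℝ), ∃ K > (0 : ℝ), ∀ t : EuclideanSpace ℂ (Fin n),
        K ≤ reNorm n t →
        R ≤ ε * (gradNorm n (expSum n A c) t) ^ k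
            - ‖iteratedFDeriv ℂ k (expSum n A c) t‖ := by
  intro ε hε k hk R hR
  obtain ⟨δ, hδ, hgrow⟩ := hconv.exists_mul_norm_le hA
  obtain ⟨C, hC, K₀, hgrad⟩ := hnd.exists_mul_exp_le_gradNorm hconv
  obtain ⟨B, hB, hder⟩ := exists_norm_iteratedFDeriv_expSum_le A hA c k
  have hD : 0 < ε * C ^ k := by positivity
  set L := (B + 1) / (ε * C ^ k) + R with hL
  have hL0 : 0 < L := by positivity
  refine ⟨max 1 (max K₀ (L / δ)), by positivity, fun t ht => ?_⟩
  obtain ⟨-, ht⟩ := max_le_iff.1 ht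
  obtain ⟨htK, htL⟩ := max_le_iff.1 ht
  set M := supportFn A hA fun j => (t j).re
  have hLM : L ≤ M := by
    rw [div_le_iff₀' hδ] at htL
    exact htL.trans (hgrow fun j => (t j).re)
  set E := Real.exp M
  have hLE : L ≤ E := by linarith [Real.add_one_le_exp M]
  have hE1 : 1 ≤ E := Real.one_le_exp (hL0.le.trans hLM)
  have hRE : R ≤ E := by
    have : 0 ≤ (B + 1) / (ε * C ^ k) := by positivity
    linarith
  have hDE : B + 1 ≤ ε * C ^ k * E := by
    rw [← div_le_iff₀' hD]
    linarith
  have hpow : ε * C ^ k * E ^ 2 ≤ ε * gradNorm n (expSum n A c) t ^ k := by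
    calc ε * C ^ k * E ^ 2 ≤ ε * C ^ k * E ^ k := by gcongr
      _ = ε * (C * E) ^ k := by rw [mul_pow, mul_assoc]
      _ ≤ _ := by gcongr; exact hgrad t htK
  nlinarith [hder t, mul_le_mul_of_nonneg_right hDE (zero_le_one.trans hE1)]
end

section
/- Let (A, c) be convenient and non-degenerate data. Let u ∈ ℝ^n with u ≠ 0 and let A_u be the corresponding face subset of A. Then there exists a constant c₀ > 0 such that for every y ∈ ℝ^n, Σ_{i=1}^n | Σ_{α∈A_u} c(α) α_i exp(i ⟨α, y⟩) |² ≥ c₀, where i denotes the imaginary unit and ⟨α, y⟩ = Σ_{j=1}^n α_j y_j. -/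
open scoped BigOperators

/-- For convenient data the support function of the Newton polytope is positive away from `0`. -/
theorem Convenient.sup'_pos {n : ℕ} {A : Finset (Fin n → ℤ)} (h : Convenient n A)
    (hA : A.Nonempty) {u : Fin n → ℝ} (hu : u ≠ 0) :
    0 < A.sup' hA (fun β => ∑ j : Fin n, (β j : ℝ) * u j) := by
  by_contra! hM
  have hsub : convexHull ℝ ((fun α : Fin n → ℤ => fun j => (α j : ℝ)) '' (A : Set (Fin n → ℤ)))
      ⊆ {x : Fin n → ℝ | x ⬝ᵥ u ≤ 0} := by
    refine convexHull_min ?_ (convex_halfSpace_le ⟨fun x y => add_dotProduct x y u,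
      fun r x => smul_dotProduct r x u⟩ 0)
    rintro _ ⟨α, hα, rfl⟩
    exact (Finset.le_sup' (fun β : Fin n → ℤ => ∑ j : Fin n, (β j : ℝ) * u j) hα).trans hM
  have hnhds := mem_interior_iff_mem_nhds.1 h
  have hlim : Filter.Tendsto (fun t : ℝ => t • u) (nhdsWithin 0 (Set.Ioi 0)) (nhds 0) := by
    have : Continuous fun t : ℝ => t • u := by fun_prop
    simpa using (this.tendsto 0).mono_left nhdsWithin_le_nhds
  obtain ⟨t, ht, ht0⟩ := ((hlim.eventually hnhds).and self_mem_nhdsWithin).exists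
  have hle : (t • u) ⬝ᵥ u ≤ 0 := hsub ht
  have hpos : 0 < u ⬝ᵥ u := by
    refine lt_of_le_of_ne (Finset.sum_nonneg fun i _ => mul_self_nonneg _) fun h0 => hu ?_
    exact dotProduct_self_eq_zero.1 h0.symm
  rw [smul_dotProduct, smul_eq_mul] at hle
  exact absurd hle (not_le.2 (mul_pos ht0 hpos))

/-- For convenient non-degenerate data and `u ≠ 0`, the logarithmic derivatives of the face
polynomial alone have no common zero on `(ℂ∖{0})^n`. -/
theorem NonDegenerate.exists_logDeriv_ne_zero {n : ℕ} {A : Finset (Fin n → ℤ)} {hA : A.Nonempty}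
    {c : (Fin n → ℤ) → ℂ} (hnd : NonDegenerate n A hA c) (hconv : Convenient n A)
    {u : Fin n → ℝ} (hu : u ≠ 0) {z : Fin n → ℂ} (hz : ∀ j, z j ≠ 0) :
    ∃ i : Fin n, (∑ α ∈ faceSet n A hA u, c α * (α i : ℂ) * ∏ j : Fin n, z j ^ (α j)) ≠ 0 := by
  by_contra! h
  refine hnd u ⟨z, hz, ?_, h⟩
  set M := A.sup' hA (fun β => ∑ j : Fin n, (β j : ℝ) * u j) with hMdef
  have hM : (M : ℂ) ≠ 0 := Complex.ofReal_ne_zero.2 (hconv.sup'_pos hA hu).ne'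
  refine (mul_eq_zero.1 ?_).resolve_left hM
  calc (M : ℂ) * ∑ α ∈ faceSet n A hA u, c α * ∏ j : Fin n, z j ^ (α j)
      = ∑ α ∈ faceSet n A hA u, ∑ i : Fin n,
          (u i : ℂ) * (c α * (α i : ℂ) * ∏ j : Fin n, z j ^ (α j)) := by
        rw [Finset.mul_sum]
        refine Finset.sum_congr rfl fun α hα => ?_
        have hα' : ∑ j : Fin n, (α j : ℝ) * u j = M := (Finset.mem_filter.1 hα).2
        rw [← hα']
        push_cast
        rw [Finset.sum_mul]
        exact Finset.sum_congr rfl fun i _ => by ring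
    _ = 0 := by
        rw [Finset.sum_comm]
        refine Finset.sum_eq_zero fun i _ => ?_
        rw [← Finset.mul_sum, h i, mul_zero]

/-- The character `y ↦ e^{i⟨α,y⟩}` is the monomial `z^α` at `z_j = e^{iy_j}`. -/
theorem exp_I_mul_sum_eq_prod_zpow {n : ℕ} (α : Fin n → ℤ) (y : Fin n → ℝ) :
    Complex.exp (Complex.I * ((∑ j : Fin n, α j * y j : ℝ) : ℂ))
      = ∏ j : Fin n, Complex.exp (y j * Complex.I) ^ (α j) := by
  push_cast
  rw [Finset.mul_sum, Complex.exp_sum]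
  refine Finset.prod_congr rfl fun j _ => ?_
  rw [← Complex.exp_int_mul]
  congr 1
  ring

/-- for convenient non-degenerate data and `u ≠ 0`, the periodic function
`y ↦ Σ_i |Σ_{α ∈ A_u} c(α) α_i e^{i⟨α,y⟩}|²` is uniformly bounded below by a positive
constant. -/
theorem stmt6 (n : ℕ) (hn : 0 < n) (A : Finset (Fin n → ℤ)) (hA : A.Nonempty)
    (c : (Fin n → ℤ) → ℂ) (hc : ∀ α ∈ A, c α ≠ 0)
    (hconv : Convenient n A) (hnd : NonDegenerate n A hA c)
    (u : Fin n → ℝ) (hu : u ≠ 0) :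
    ∃ c₀ > (0 : ℝ), ∀ y : Fin n → ℝ,
      c₀ ≤ ∑ i : Fin n, ‖∑ α ∈ faceSet n A hA u,
        c α * (α i : ℂ) * Complex.exp (Complex.I * ((∑ j : Fin n, α j * y j : ℝ) : ℂ))‖ ^ 2 := by
  set K : Set (Fin n → ℂ) := Set.univ.pi fun _ => Metric.sphere 0 1
  have hK : IsCompact K := isCompact_univ_pi fun _ => isCompact_sphere 0 1
  have hK0 : ∀ z ∈ K, ∀ j, z j ≠ 0 := fun z hz j =>
    ne_zero_of_mem_unit_sphere ⟨z j, hz j (Set.mem_univ j)⟩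
  have hcont : ContinuousOn (fun z : Fin n → ℂ => ∑ i : Fin n, ‖∑ α ∈ faceSet n A hA u,
      c α * (α i : ℂ) * ∏ j : Fin n, z j ^ (α j)‖ ^ 2) K := by
    refine continuousOn_finsetSum _ fun i _ => ContinuousOn.pow (ContinuousOn.norm
      (continuousOn_finsetSum _ fun α _ => continuousOn_const.mul
        (continuousOn_finsetProd _ fun j _ => ?_))) 2
    exact (continuous_apply j).continuousOn.zpow₀ _ fun z hz => Or.inl (hK0 z hz j)
  obtain ⟨z, hz, hmin⟩ := hK.exists_isMinOn
    ⟨fun _ => 1, fun _ _ => by simp⟩ hcont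
  refine ⟨∑ i : Fin n, ‖∑ α ∈ faceSet n A hA u,
    c α * (α i : ℂ) * ∏ j : Fin n, z j ^ (α j)‖ ^ 2, ?_, fun y => ?_⟩
  · obtain ⟨i, hi⟩ := hnd.exists_logDeriv_ne_zero hconv hu (hK0 z hz)
    exact Finset.sum_pos' (fun _ _ => sq_nonneg _)
      ⟨i, Finset.mem_univ i, pow_pos (norm_pos_iff.2 hi) 2⟩
  · simp only [exp_I_mul_sum_eq_prod_zpow]
    exact hmin (a := fun j => Complex.exp (y j * Complex.I)) fun j _ => by
      simp [Complex.norm_exp_ofReal_mul_I]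
end
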